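/- Let (M(t))_{t∈I} be a flow line of the vector field v that is not the constant solution at the origin. Then the set of times t ∈ I at which M(t) ∈ X contains at most one element. -/

import Mathlib

open Set Filter

/-- The vector field `v(x,y) = ((γy - x) φ(x² + axy + by²), (y + γx) φ(y² - axy + bx²))`,
with `a = γ + 1` and `b = γ² + γ + 1`. -/
def vf (γ : ℝ) (φ : ℝ → ℝ) (p : ℝ × ℝ) : ℝ × ℝ :=
  ((γ * p.2 - p.1) * φ (p.1 ^ 2 + (γ + 1) * p.1 * p.2 + (γ ^ 2 + γ + 1) * p.2 ^ 2),
   (p.2 + γ * p.1) * φ (p.2 ^ 2 - (γ + 1) * p.1 * p.2 + (γ ^ 2 + γ + 1) * p.1 ^ 2))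

/-- The set `X = {(x,y) : x = γy or y = -γx}`. -/
def Xset (γ : ℝ) : Set (ℝ × ℝ) := {p | p.1 = γ * p.2 ∨ p.2 = -γ * p.1}

lemma aux_zero {a b : ℝ} {f f' : ℝ → ℝ} (hab : a < b)
    (hf : ∀ t ∈ Icc a b, HasDerivWithinAt f (f' t) (Icc a b) t)
    (ha : f a = 0) (hb : f b = 0) (hneg : ∀ t ∈ Icc a b, f t = 0 → f' t < 0) : False := by
  have hc : ContinuousOn f (Icc a b) := fun t ht => (hf t ht).continuousWithinAt
  have hle : ∀ ⦃x⦄, x ∈ Icc a b → f x ≤ (fun _ => (0:ℝ)) x := by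
    apply image_le_of_deriv_right_lt_deriv_boundary' (f' := f') (B := fun _ => (0:ℝ)) (B' := fun _ => (0:ℝ)) hc
    · intro x hx
      exact (hf x ⟨hx.1, hx.2.le⟩).mono_of_mem_nhdsWithin (Icc_mem_nhdsGE_of_mem hx)
    · simp [ha]
    · exact continuousOn_const
    · intro x hx
      exact hasDerivWithinAt_const _ _ _
    · intro x hx h
      exact hneg x ⟨hx.1, hx.2.le⟩ h
  have hbm : b ∈ Icc a b := right_mem_Icc.2 hab.le
  have h1 : HasDerivWithinAt f (f' b) (Iio b) b :=
    (hf b hbm).mono_of_mem_nhdsWithin (Icc_mem_nhdsLT hab)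
  have h2 := (hasDerivWithinAt_iff_tendsto_slope' (by simp)).1 h1
  have h3 : 0 ≤ f' b := by
    apply ge_of_tendsto h2
    filter_upwards [Ioo_mem_nhdsLT hab] with x hx
    rw [slope_def_field, hb]
    have := hle ⟨hx.1.le, hx.2.le⟩
    simp only at this
    apply div_nonneg_of_nonpos <;> linarith [hx.2]
  exact absurd (hneg b hbm hb) (not_lt.2 h3)

lemma aux_q1 (γ x y : ℝ) : 0 ≤ x ^ 2 + (γ + 1) * x * y + (γ ^ 2 + γ + 1) * y ^ 2 := by
  nlinarith [sq_nonneg (2 * x + (γ + 1) * y), sq_nonneg y, sq_nonneg ((3 * γ + 1) * y)]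

lemma aux_q2 (γ x y : ℝ) : 0 ≤ y ^ 2 - (γ + 1) * x * y + (γ ^ 2 + γ + 1) * x ^ 2 := by
  nlinarith [sq_nonneg (2 * y - (γ + 1) * x), sq_nonneg x, sq_nonneg ((3 * γ + 1) * x)]

lemma aux_bound (γ : ℝ) (hγ : 0 < γ) (φ : ℝ → ℝ) (hφ : ContinuousOn φ (Ici 0)) (a b : ℝ)
    (M : ℝ → ℝ × ℝ) (hM : ContinuousOn M (Icc a b)) :
    ∃ K, ∀ t ∈ Icc a b, ‖vf γ φ (M t)‖ ≤ K * ‖M t‖ := by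
  have c1 : ContinuousOn (fun t => φ ((M t).1 ^ 2 + (γ + 1) * (M t).1 * (M t).2
      + (γ ^ 2 + γ + 1) * (M t).2 ^ 2)) (Icc a b) :=
    hφ.comp (by fun_prop) (fun t _ => aux_q1 _ _ _)
  have c2 : ContinuousOn (fun t => φ ((M t).2 ^ 2 - (γ + 1) * (M t).1 * (M t).2
      + (γ ^ 2 + γ + 1) * (M t).1 ^ 2)) (Icc a b) :=
    hφ.comp (by fun_prop) (fun t _ => aux_q2 _ _ _)
  obtain ⟨C1, h1⟩ := isCompact_Icc.exists_bound_of_continuousOn c1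
  obtain ⟨C2, h2⟩ := isCompact_Icc.exists_bound_of_continuousOn c2
  refine ⟨(γ + 1) * max C1 C2, fun t ht => ?_⟩
  have k1 := (h1 t ht).trans (le_max_left C1 C2)
  have k2 := (h2 t ht).trans (le_max_right C1 C2)
  have n1 : ‖(M t).1‖ ≤ ‖M t‖ := norm_fst_le _
  have n2 : ‖(M t).2‖ ≤ ‖M t‖ := norm_snd_le _
  have e1 : ‖γ * (M t).2 - (M t).1‖ ≤ (γ + 1) * ‖M t‖ := by
    refine (norm_sub_le _ _).trans ?_
    rw [norm_mul, Real.norm_of_nonneg hγ.le]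
    nlinarith
  have e2 : ‖(M t).2 + γ * (M t).1‖ ≤ (γ + 1) * ‖M t‖ := by
    refine (norm_add_le _ _).trans ?_
    rw [norm_mul, Real.norm_of_nonneg hγ.le]
    nlinarith
  have hp : 0 ≤ (γ + 1) * ‖M t‖ := by positivity
  rw [mul_right_comm]
  refine norm_prod_le_iff.2 ⟨?_, ?_⟩
  · simp only [vf]
    rw [norm_mul]
    exact mul_le_mul e1 k1 (norm_nonneg _) hp
  · simp only [vf]
    rw [norm_mul]
    exact mul_le_mul e2 k2 (norm_nonneg _) hp

lemma aux_fwd {f f' : ℝ → ℝ × ℝ} {a b K : ℝ} (hab : a ≤ b)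
    (hf : ∀ t ∈ Icc a b, HasDerivWithinAt f (f' t) (Icc a b) t)
    (hK : ∀ t ∈ Icc a b, ‖f' t‖ ≤ K * ‖f t‖) (ha : f a = 0) : f b = 0 := by
  refine eq_zero_of_abs_deriv_le_mul_abs_self_of_eq_zero_right (K := K) (f' := f')
    (fun t ht => (hf t ht).continuousWithinAt) ?_ ha ?_ b (right_mem_Icc.2 hab)
  · intro x hx
    exact (hf x ⟨hx.1, hx.2.le⟩).mono_of_mem_nhdsWithin (Icc_mem_nhdsGE_of_mem hx)
  · intro x hx
    exact hK x ⟨hx.1, hx.2.le⟩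

lemma aux_bwd {f f' : ℝ → ℝ × ℝ} {a b K : ℝ} (hab : a ≤ b)
    (hf : ∀ t ∈ Icc a b, HasDerivWithinAt f (f' t) (Icc a b) t)
    (hK : ∀ t ∈ Icc a b, ‖f' t‖ ≤ K * ‖f t‖) (hb : f b = 0) : f a = 0 := by
  have hm : MapsTo (fun x : ℝ => -x) (Icc (-b) (-a)) (Icc a b) := by
    intro x hx
    exact ⟨by linarith [hx.2], by linarith [hx.1]⟩
  have := aux_fwd (f := fun t => f (-t)) (f' := fun t => -(f' (-t))) (a := -b) (b := -a) (K := K)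
    (by linarith) ?_ ?_ (by simpa using hb)
  · simpa using this
  · intro t ht
    have h := HasDerivWithinAt.scomp t (hf (-t) (hm ht)) (hasDerivWithinAt_neg t (Icc (-b) (-a))) hm
    simpa [Function.comp_def] using h
  · intro t ht
    simpa using hK (-t) (hm ht)

/-- A flow line of `v` that is not the constant solution at the origin meets the set `X`
at most once. -/
theorem statement_11 (γ : ℝ) (hγ : γ ^ 3 + γ ^ 2 + γ - 1 / 3 = 0)
    (φ : ℝ → ℝ) (hφsmooth : ContDiffOn ℝ (⊤ : ℕ∞) φ (Ici 0))
    (hφmono : MonotoneOn φ (Ici 0))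
    (hφone : ∀ t ∈ Ici (0 : ℝ), 1 ≤ φ t)
    (hφlow : ∀ t ∈ Icc (0 : ℝ) (1 / 2), φ t = 1)
    (hφhigh : ∀ t ∈ Ici (1 : ℝ), φ t = 2 * t)
    (I : Set ℝ) (hI : I.OrdConnected)
    (M : ℝ → ℝ × ℝ)
    (hflow : ∀ t ∈ I, HasDerivWithinAt M (vf γ φ (M t)) I t)
    (hnc : ¬ ∀ t ∈ I, M t = (0, 0)) :
    {t | t ∈ I ∧ M t ∈ Xset γ}.Subsingleton := by
  have hγ0 : 0 < γ := by
    by_contra h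
    push Not at h
    nlinarith [sq_nonneg (γ + 1 / 2), mul_nonneg (neg_nonneg.2 h) (add_nonneg (sq_nonneg γ) (add_nonneg (sq_nonneg (γ + 1)) zero_le_one)), mul_nonneg (neg_nonneg.2 h) (sq_nonneg (γ + 1/2))]
  have hφc : ContinuousOn φ (Ici 0) := hφsmooth.continuousOn
  have hMc : ContinuousOn M I := fun t ht => (hflow t ht).continuousWithinAt
  have hne : ∀ t ∈ I, M t ≠ 0 := by
    intro s hs h0
    apply hnc
    intro t ht
    rcases le_total s t with h | h
    · have hsub : Icc s t ⊆ I := hI.out hs ht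
      obtain ⟨K, hK⟩ := aux_bound γ hγ0 φ hφc s t M (hMc.mono hsub)
      exact aux_fwd h (fun x hx => (hflow x (hsub hx)).mono hsub) hK h0
    · have hsub : Icc t s ⊆ I := hI.out ht hs
      obtain ⟨K, hK⟩ := aux_bound γ hγ0 φ hφc t s M (hMc.mono hsub)
      exact aux_bwd h (fun x hx => (hflow x (hsub hx)).mono hsub) hK h0
  have key : ∀ s ∈ I, ∀ t ∈ I, M s ∈ Xset γ → M t ∈ Xset γ → ¬ s < t := by
    intro s hs t ht hXs hXt hst
    have hsub : Icc s t ⊆ I := hI.out hs ht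
    have hX : ∀ r, M r ∈ Xset γ →
        ((M r).1 - γ * (M r).2) * ((M r).2 + γ * (M r).1) = 0 := by
      rintro r (h | h)
      · rw [h]; ring
      · rw [h]; ring
    refine aux_zero (f := fun r => ((M r).1 - γ * (M r).2) * ((M r).2 + γ * (M r).1))
      (f' := fun r => ((vf γ φ (M r)).1 - γ * (vf γ φ (M r)).2) * ((M r).2 + γ * (M r).1)
        + ((M r).1 - γ * (M r).2) * ((vf γ φ (M r)).2 + γ * (vf γ φ (M r)).1))
      hst ?_ (hX s hXs) (hX t hXt) ?_
    · intro r hr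
      have hd := (hflow r (hsub hr)).mono hsub
      have d1 : HasDerivWithinAt (fun r => (M r).1) (vf γ φ (M r)).1 (Icc s t) r := hd.fst
      have d2 : HasDerivWithinAt (fun r => (M r).2) (vf γ φ (M r)).2 (Icc s t) r := hd.snd
      exact (d1.sub (d2.const_mul γ)).mul (d2.add (d1.const_mul γ))
    · intro r hr h0
      have hn := hne r (hsub hr)
      have p1 := hφone _ (aux_q1 γ (M r).1 (M r).2)
      have p2 := hφone _ (aux_q2 γ (M r).1 (M r).2)
      simp only [vf]
      generalize φ ((M r).1 ^ 2 + (γ + 1) * (M r).1 * (M r).2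
        + (γ ^ 2 + γ + 1) * (M r).2 ^ 2) = A at *
      generalize φ ((M r).2 ^ 2 - (γ + 1) * (M r).1 * (M r).2
        + (γ ^ 2 + γ + 1) * (M r).1 ^ 2) = B at *
      have hn' : ¬ ((M r).1 = 0 ∧ (M r).2 = 0) := fun h => hn (Prod.ext h.1 h.2)
      generalize (M r).1 = x at *
      generalize (M r).2 = y at *
      have hpos : 0 < x ^ 2 + y ^ 2 := by
        by_contra hc
        push Not at hc
        exact hn' ⟨by nlinarith [sq_nonneg x, sq_nonneg y], by nlinarith [sq_nonneg x, sq_nonneg y]⟩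
      have hpos2 : 0 < (x - γ * y) ^ 2 + (y + γ * x) ^ 2 := by
        have : (x - γ * y) ^ 2 + (y + γ * x) ^ 2 = (1 + γ ^ 2) * (x ^ 2 + y ^ 2) := by ring
        rw [this]; positivity
      have e : ((γ * y - x) * A - γ * ((y + γ * x) * B)) * (y + γ * x)
          + (x - γ * y) * ((y + γ * x) * B + γ * ((γ * y - x) * A))
          = (B - A) * ((x - γ * y) * (y + γ * x))
            - γ * ((x - γ * y) ^ 2 * A + (y + γ * x) ^ 2 * B) := by ring
      rw [e, h0]
      have : 0 < (x - γ * y) ^ 2 * A + (y + γ * x) ^ 2 * B := by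
        nlinarith [sq_nonneg (x - γ * y), sq_nonneg (y + γ * x)]
      have := mul_pos hγ0 this
      linarith
  rintro s ⟨hs, hXs⟩ t ⟨ht, hXt⟩
  rcases lt_trichotomy s t with h | h | h
  · exact absurd h (key s hs t ht hXs hXt)
  · exact h
  · exact absurd h (key t ht s hs hXt hXs)
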